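/- Let B be a strongly abelian algebra and θ a congruence on B such that the quotient B/θ is abelian but not strongly rectangular. Then there exist a substructure C of B × B and a congruence γ on C such that the quotient C/γ is not abelian. -/

import Mathlib

namespace UA

/-- An algebraic language: a type of operation symbols with arities. -/
structure Lang where
  F : Type
  arity : F → ℕ

variable {L : Lang}

/-- An interpretation of the language `L` on the carrier `A` (an algebra structure). -/
def Interp (L : Lang) (A : Type) : Type :=
  (f : L.F) → ((Fin (L.arity f)) → A) → A

/-- Terms of the language `L` over a type `X` of variables. -/
inductive Term (L : Lang) (X : Type) : Type
  | var : X → Term L X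
  | app : (f : L.F) → ((Fin (L.arity f)) → Term L X) → Term L X

/-- Realization of a term under an assignment of the variables. -/
def Term.realize {A X : Type} (I : Interp L A) (v : X → A) : Term L X → A
  | .var x => v x
  | .app f ts => I f (fun i => (ts i).realize I v)

/-- Relabelling (substitution of variables) of terms. -/
def Term.relabel {X Y : Type} (g : X → Y) : Term L X → Term L Y
  | .var x => .var (g x)
  | .app f ts => .app f (fun i => (ts i).relabel g)

/-- `p` is a polynomial operation of the algebra `(A, I)` with argument-index type `X`:
it is the realization of a term in variables `X ⊕ Fin m` where the `Fin m` variables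
are evaluated at fixed constants. -/
def IsPolyOp {A X : Type} (I : Interp L A) (p : (X → A) → A) : Prop :=
  ∃ (m : ℕ) (t : Term L (X ⊕ Fin m)) (c : Fin m → A),
    ∀ x : X → A, p x = t.realize I (Sum.elim x c)

/-- A unary polynomial operation. -/
def IsUnaryPolyOp {A : Type} (I : Interp L A) (g : A → A) : Prop :=
  IsPolyOp I (fun x : Fin 1 → A => g (x 0))

/-- `(p, q, r, s)` is a `1,1`-matrix of the algebra `(A, I)`. -/
def Is11Matrix {A : Type} (I : Interp L A) (p q r s : A) : Prop :=
  ∃ (k l : ℕ) (t : ((Fin k ⊕ Fin l) → A) → A), IsPolyOp I t ∧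
    ∃ (a b : Fin k → A) (u v : Fin l → A),
      p = t (Sum.elim a u) ∧ q = t (Sum.elim a v) ∧
      r = t (Sum.elim b u) ∧ s = t (Sum.elim b v)

/-- The algebra is abelian: in every `1,1`-matrix, `p = q` implies `r = s`. -/
def IsAbelian {A : Type} (I : Interp L A) : Prop :=
  ∀ p q r s : A, Is11Matrix I p q r s → p = q → r = s

/-- The algebra is strongly rectangular: in every `1,1`-matrix, `q = r` implies `r = s`. -/
def IsStronglyRectangular {A : Type} (I : Interp L A) : Prop :=
  ∀ p q r s : A, Is11Matrix I p q r s → q = r → r = s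

/-- Strongly abelian = abelian + strongly rectangular. -/
def IsStronglyAbelian {A : Type} (I : Interp L A) : Prop :=
  IsAbelian I ∧ IsStronglyRectangular I

/-- The algebra has a Maltsev polynomial operation. -/
def HasMaltsevPoly {A : Type} (I : Interp L A) : Prop :=
  ∃ mOp : (Fin 3 → A) → A, IsPolyOp I mOp ∧
    ∀ x y : A, mOp ![x, y, y] = x ∧ mOp ![y, y, x] = x

/-- Affine = abelian + has a Maltsev polynomial operation. -/
def IsAffine {A : Type} (I : Interp L A) : Prop :=
  IsAbelian I ∧ HasMaltsevPoly I

/-- The algebra satisfies the identity `e.1 ≈ e.2`. -/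
def Satisfies {A : Type} (I : Interp L A) (e : Term L ℕ × Term L ℕ) : Prop :=
  ∀ v : ℕ → A, e.1.realize I v = e.2.realize I v

/-- Membership in the variety `Mod(E)` axiomatized by the set `E` of identities. -/
def InVariety {A : Type} (E : Set (Term L ℕ × Term L ℕ)) (I : Interp L A) : Prop :=
  ∀ e ∈ E, Satisfies I e

/-- `θ` is a congruence on the algebra `(A, I)`. -/
def IsCong {A : Type} (I : Interp L A) (θ : A → A → Prop) : Prop :=
  Equivalence θ ∧
    ∀ (f : L.F) (a b : Fin (L.arity f) → A),
      (∀ i, θ (a i) (b i)) → θ (I f a) (I f b)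

/-- `(p, q, r, s)` is a `θ`-matrix of the algebra `(A, I)`. -/
def IsThetaMatrix {A : Type} (I : Interp L A) (θ : A → A → Prop) (p q r s : A) : Prop :=
  ∃ (k l : ℕ) (t : ((Fin k ⊕ Fin l) → A) → A), IsPolyOp I t ∧
    ∃ (a b : Fin k → A) (u v : Fin l → A),
      (∀ i, θ (a i) (b i)) ∧ (∀ j, θ (u j) (v j)) ∧
      p = t (Sum.elim a u) ∧ q = t (Sum.elim a v) ∧
      r = t (Sum.elim b u) ∧ s = t (Sum.elim b v)

/-- `θ` is a strongly abelian congruence. -/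
def IsStronglyAbelianCong {A : Type} (I : Interp L A) (θ : A → A → Prop) : Prop :=
  ∀ p q r s : A, IsThetaMatrix I θ p q r s → (p = q → r = s) ∧ (q = r → r = s)

/-- `S` is a subuniverse of the algebra `(A, I)`. -/
def IsSubuniverse {A : Type} (I : Interp L A) (S : Set A) : Prop :=
  ∀ (f : L.F) (a : Fin (L.arity f) → A), (∀ i, a i ∈ S) → I f a ∈ S

/-- The substructure (restricted algebra structure) on a subuniverse. -/
def subInterp {A : Type} (I : Interp L A) (S : Set A) (hS : IsSubuniverse I S) :
    Interp L S :=
  fun f a => ⟨I f (fun i => (a i : A)), hS f _ (fun i => (a i).2)⟩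

/-- The componentwise algebra structure on a product. -/
def prodInterp {ι : Type} {A : ι → Type} (I : ∀ i, Interp L (A i)) :
    Interp L (∀ i, A i) :=
  fun f a i => I i f (fun j => a j i)

/-- The componentwise algebra structure on `A × A`. -/
def pairInterp {A : Type} (I : Interp L A) : Interp L (A × A) :=
  fun f a => (I f (fun i => (a i).1), I f (fun i => (a i).2))

/-- `h` is a homomorphism of `L`-algebras. -/
def IsHom {A B : Type} (I : Interp L A) (J : Interp L B) (h : A → B) : Prop :=
  ∀ (f : L.F) (a : Fin (L.arity f) → A), h (I f a) = J f (fun i => h (a i))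

/-- The induced algebra structure on the quotient by a congruence `ρ`
(well-defined, i.e. independent of the chosen representatives, when `ρ` is a congruence). -/
noncomputable def quotInterp {A : Type} (I : Interp L A) (ρ : A → A → Prop) :
    Interp L (Quot ρ) :=
  fun f a => Quot.mk ρ (I f (fun i => (a i).out))

/-- The subuniverse generated by a subset `G`: the intersection of all
subuniverses containing `G`. -/
def GenSub {A : Type} (I : Interp L A) (G : Set A) : Set A :=
  {x | ∀ S : Set A, IsSubuniverse I S → G ⊆ S → x ∈ S}

theorem genSub_isSubuniverse {A : Type} (I : Interp L A) (G : Set A) :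
    IsSubuniverse I (GenSub I G) :=
  fun f a ha S hS hG => hS f a (fun i => ha i S hS hG)

/-- The smallest congruence containing the pair `(x, y)`: the intersection of all
congruences containing it. -/
def genCong {A : Type} (I : Interp L A) (x y : A) : A → A → Prop :=
  fun w z => ∀ ρ : A → A → Prop, IsCong I ρ → ρ x y → ρ w z

/-- The carrier of `A(θ)`, the graph of `θ` inside `A × A`. -/
abbrev ThetaSub {A : Type} (θ : A → A → Prop) : Type := {z : A × A // θ z.1 z.2}

/-- The substructure `A(θ) ≤ A × A` supported by the graph of `θ`. -/
def thetaSubInterp {A : Type} (I : Interp L A) (θ : A → A → Prop) (hθ : IsCong I θ) :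
    Interp L (ThetaSub θ) :=
  fun f a => ⟨(I f (fun i => (a i).1.1), I f (fun i => (a i).1.2)),
    hθ.2 f _ _ (fun i => (a i).2)⟩

/-- The diagonal element `(c, c)` of `A(θ)`. -/
def diagEl {A : Type} {θ : A → A → Prop} (hrefl : ∀ a : A, θ a a) (c : A) :
    ThetaSub θ := ⟨(c, c), hrefl c⟩

/-- `Δ`: the smallest congruence of `A(θ)` containing `D × D`, where `D` is the
diagonal -- the intersection of all congruences of `A(θ)` containing `D × D`. -/
def DeltaRel {A : Type} (I : Interp L A) (θ : A → A → Prop) (hθ : IsCong I θ) :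
    ThetaSub θ → ThetaSub θ → Prop :=
  fun x y => ∀ ρ : ThetaSub θ → ThetaSub θ → Prop,
    IsCong (thetaSubInterp I θ hθ) ρ →
    (∀ c d : A, ρ (diagEl hθ.1.refl c) (diagEl hθ.1.refl d)) → ρ x y

/-- The quotient algebra `S = A(θ)/Δ`. -/
noncomputable def SInterp {A : Type} (I : Interp L A) (θ : A → A → Prop)
    (hθ : IsCong I θ) : Interp L (Quot (DeltaRel I θ hθ)) :=
  quotInterp (thetaSubInterp I θ hθ) (DeltaRel I θ hθ)

/-- The element `0` of `S = A(θ)/Δ`: the `Δ`-class of a diagonal element. -/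
def zeroS {A : Type} (I : Interp L A) (θ : A → A → Prop) (hθ : IsCong I θ) (d : A) :
    Quot (DeltaRel I θ hθ) :=
  Quot.mk _ (diagEl hθ.1.refl d)

/-- The diagonal of `B × B`. -/
def diagSet (B : Type) : Set (B × B) := {z | z.1 = z.2}

/-- The set of pairs `(u j, v j)`. -/
def pairsSet {B : Type} {l : ℕ} (u v : Fin l → B) : Set (B × B) :=
  {z | ∃ j, z = (u j, v j)}

/-- The carrier of the subalgebra `C ≤ B × B` generated by the diagonal and the
pairs `(u j, v j)`. -/
def CsetOf {L : Lang} {B : Type} (I : Interp L B) {l : ℕ} (u v : Fin l → B) :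
    Set (B × B) :=
  GenSub (pairInterp I) (diagSet B ∪ pairsSet u v)

/-- The subalgebra `C ≤ B × B` generated by the diagonal and the pairs `(u j, v j)`. -/
def CInterpOf {L : Lang} {B : Type} (I : Interp L B) {l : ℕ} (u v : Fin l → B) :
    Interp L (CsetOf I u v) :=
  subInterp (pairInterp I) _ (genSub_isSubuniverse _ _)


/-- Simultaneous substitution of terms for the variables of a term. -/
def Term.bind {X Y : Type} (σ : X → Term L Y) : Term L X → Term L Y
  | .var x => σ x
  | .app f ts => .app f (fun i => (ts i).bind σ)

theorem Term.realize_bind {A X Y : Type} (I : Interp L A) (σ : X → Term L Y) (v : Y → A)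
    (t : Term L X) :
    (t.bind σ).realize I v = t.realize I (fun x => (σ x).realize I v) := by
  induction t with
  | var x => rfl
  | app f ts ih => simp only [Term.bind, Term.realize, ih]

theorem IsHom.map_realize {A B X : Type} {I : Interp L A} {J : Interp L B} {h : A → B}
    (hh : IsHom I J h) (v : X → A) (t : Term L X) :
    h (t.realize I v) = t.realize J (fun x => h (v x)) := by
  induction t with
  | var x => rfl
  | app f ts ih => simp only [Term.realize, hh f, ih]

theorem IsCong.isHom_mk {A : Type} {I : Interp L A} {θ : A → A → Prop} (hθ : IsCong I θ) :
    IsHom I (quotInterp I θ) (Quot.mk θ) := fun f a =>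
  Quot.sound (hθ.2 f _ _ fun i => (hθ.1.quot_mk_eq_iff _ _).1 (Quot.out_eq (Quot.mk θ (a i))).symm)

/-- A term involves only finitely many variables. -/
theorem Term.exists_fin_bind {X : Type} (t : Term L X) :
    ∃ (n : ℕ) (g : Fin n → X) (t' : Term L (Fin n)), t'.bind (fun i => .var (g i)) = t := by
  induction t with
  | var x => exact ⟨1, fun _ => x, .var 0, rfl⟩
  | app f ts ih =>
    choose n g t' h using ih
    let e := Fintype.equivFin (Σ i, Fin (n i))
    let g' : (Σ i, Fin (n i)) → X := fun x => g x.1 x.2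
    have bind_bind : ∀ {U V W : Type} (σ : U → Term L V) (τ : V → Term L W) (s : Term L U),
        (s.bind σ).bind τ = s.bind (fun x => (σ x).bind τ) := by
      intro U V W σ τ s
      induction s with
      | var x => rfl
      | app f ts ih => simp only [Term.bind, ih]
    refine ⟨_, fun j => g' (e.symm j),
      .app f (fun i => (t' i).bind (fun j => .var (e ⟨i, j⟩))), ?_⟩
    have hg : ∀ i j, g' (e.symm (e ⟨i, j⟩)) = g i j := fun i j => by rw [e.symm_apply_apply]
    simp only [Term.bind, bind_bind, hg, h]

/-- Four assignments such that each variable is constant along the rows or along the columns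
give rise to a `1,1`-matrix. -/
theorem is11Matrix_realize {A Z : Type} (I : Interp L A) (t : Term L Z) (e₁ e₂ e₃ e₄ : Z → A)
    (h : ∀ z, (e₁ z = e₂ z ∧ e₃ z = e₄ z) ∨ (e₁ z = e₃ z ∧ e₂ z = e₄ z)) :
    Is11Matrix I (t.realize I e₁) (t.realize I e₂) (t.realize I e₃) (t.realize I e₄) := by
  classical
  obtain ⟨n, g, t', rfl⟩ := t.exists_fin_bind
  let P : Fin n → Prop := fun i => e₁ (g i) = e₂ (g i) ∧ e₃ (g i) = e₄ (g i)
  let w : Fin n → Fin n ⊕ Fin n := fun i => if P i then .inl i else .inr i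
  refine ⟨n, n, fun x => t'.realize I (fun i => x (w i)),
    ⟨0, t'.bind (fun i => .var (.inl (w i))), Fin.elim0, fun x => ?_⟩,
    e₁ ∘ g, e₃ ∘ g, e₁ ∘ g, e₂ ∘ g, ?_, ?_, ?_, ?_⟩
  · rw [Term.realize_bind]; rfl
  all_goals
    rw [Term.realize_bind]
    congr 1
    funext i
    by_cases hP : P i
    · simp [Term.realize, w, hP, P]
    · have h' := (h (g i)).resolve_left hP
      simp [Term.realize, w, hP, h'.1, h'.2]

/-- The syntactic congruence of a relation `R`: two elements are related if every unary
polynomial sends them to `R`-related elements. The variable `none` is the argument of the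
polynomial, and `some c` stands for the constant `c`. -/
def syntacticCong {A : Type} (I : Interp L A) (R : A → A → Prop) (x y : A) : Prop :=
  ∀ t : Term L (Option A),
    R (t.realize I (fun o => o.elim x id)) (t.realize I (fun o => o.elim y id))

theorem isCong_syntacticCong {A : Type} (I : Interp L A) {R : A → A → Prop}
    (hR : Equivalence R) : IsCong I (syntacticCong I R) := by
  classical
  refine ⟨⟨fun _ _ => hR.refl _, fun h t => hR.symm (h t),
    fun h h' t => hR.trans (h t) (h' t)⟩, fun f a b hab t => ?_⟩
  suffices H : ∀ s : Finset (Fin (L.arity f)),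
      R (t.realize I (fun o => o.elim (I f a) id))
        (t.realize I (fun o => o.elim (I f (s.piecewise b a)) id)) by
    simpa using H Finset.univ
  intro s
  induction s using Finset.induction_on with
  | empty => simpa using hR.refl _
  | insert i s hi ih =>
    refine hR.trans ih ?_
    let σ : Option A → Term L (Option A) := fun o => o.elim
      (.app f (fun j => if j = i then .var none else .var (some (s.piecewise b a j))))
      (fun c => .var (some c))
    have key : ∀ x : A, (t.bind σ).realize I (fun o => o.elim x id) =
        t.realize I (fun o => o.elim (I f (Function.update (s.piecewise b a) i x)) id) := by
      intro x
      rw [Term.realize_bind]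
      congr 1
      funext o
      cases o with
      | some c => rfl
      | none =>
        simp only [σ, Option.elim, Term.realize]
        congr 1
        funext j
        by_cases hj : j = i
        · subst hj; simp [Term.realize]
        · simp [Term.realize, hj]
    have h := hab i (t.bind σ)
    rw [key, key, ← Finset.piecewise_insert] at h
    rwa [Function.update_eq_self_iff.2 (by simp [hi])] at h

theorem syntacticCong.rel {A : Type} {I : Interp L A} {R : A → A → Prop} {x y : A}
    (h : syntacticCong I R x y) : R x y :=
  h (.var none)

/-- The relation on a set of pairs which identifies diagonal pairs with `θ`-related entries,
and any two off-diagonal pairs. -/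
def diagRel {B : Type} (θ : B → B → Prop) (S : Set (B × B)) (z w : S) : Prop :=
  (z.1.1 = z.1.2 ↔ w.1.1 = w.1.2) ∧ (z.1.1 = z.1.2 → θ z.1.1 w.1.1)

theorem equivalence_diagRel {B : Type} {θ : B → B → Prop} (hθ : Equivalence θ)
    (S : Set (B × B)) : Equivalence (diagRel θ S) :=
  ⟨fun _ => ⟨Iff.rfl, fun _ => hθ.refl _⟩,
    fun h => ⟨h.1.symm, fun hw => hθ.symm (h.2 (h.1.2 hw))⟩,
    fun h h' => ⟨h.1.trans h'.1, fun hz => hθ.trans (h.2 hz) (h'.2 (h.1.1 hz))⟩⟩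

/-- In a strongly abelian algebra, consider a `1,1`-matrix `(p, q, r, s)` with `q` and `r`
congruent modulo `θ`. Then its rows `(p, q)` and `(r, s)` are related by the syntactic
congruence of `diagRel θ`. -/
theorem syntacticCong_rows {B Z : Type} {I : Interp L B} (hB : IsStronglyAbelian I)
    {θ : B → B → Prop} (hθ : IsCong I θ) {S : Set (B × B)} (hS : IsSubuniverse (pairInterp I) S)
    (t₀ : Term L Z) (e₁ e₂ e₃ e₄ : Z → B)
    (he : ∀ z, (e₁ z = e₂ z ∧ e₃ z = e₄ z) ∨ (e₁ z = e₃ z ∧ e₂ z = e₄ z))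
    (hqr : θ (t₀.realize I e₂) (t₀.realize I e₃))
    (h₁ : (t₀.realize I e₁, t₀.realize I e₂) ∈ S) (h₂ : (t₀.realize I e₃, t₀.realize I e₄) ∈ S) :
    syntacticCong (subInterp (pairInterp I) S hS) (diagRel θ S) ⟨_, h₁⟩ ⟨_, h₂⟩ := by
  intro t
  have fst_hom : IsHom (subInterp (pairInterp I) S hS) I (fun z => z.1.1) := fun _ _ => rfl
  have snd_hom : IsHom (subInterp (pairInterp I) S hS) I (fun z => z.1.2) := fun _ _ => rfl
  let G₁ : B → B := fun x => t.realize I (fun o => o.elim x (fun c => c.1.1))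
  let G₂ : B → B := fun x => t.realize I (fun o => o.elim x (fun c => c.1.2))
  have hG₁ : ∀ x : S, (t.realize (subInterp (pairInterp I) S hS)
      (fun o => o.elim x id)).1.1 = G₁ x.1.1 := fun x => by
    rw [fst_hom.map_realize]
    congr 1
    funext o
    cases o <;> rfl
  have hG₂ : ∀ x : S, (t.realize (subInterp (pairInterp I) S hS)
      (fun o => o.elim x id)).1.2 = G₂ x.1.2 := fun x => by
    rw [snd_hom.map_realize]
    congr 1
    funext o
    cases o <;> rfl
  have cross : ∀ x y, G₁ x = G₂ y → G₂ y = G₁ y := fun x y =>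
    hB.2 _ _ _ _ (is11Matrix_realize I t (fun o => o.elim x (fun c => c.1.2)) _ _ _
      (fun o => by cases o <;> simp))
  have transfer : ∀ x y, G₁ x = G₂ x → G₁ y = G₂ y := fun x y =>
    hB.1 _ _ _ _ (is11Matrix_realize I t _ _ _ _ (fun o => by cases o <;> simp))
  have rows : ∀ f₁ f₂ f₃ f₄ : Z → B,
      (∀ z, (f₁ z = f₂ z ∧ f₃ z = f₄ z) ∨ (f₁ z = f₃ z ∧ f₂ z = f₄ z)) →
      G₁ (t₀.realize I f₁) = G₁ (t₀.realize I f₂) →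
      G₁ (t₀.realize I f₃) = G₁ (t₀.realize I f₄) := by
    intro f₁ f₂ f₃ f₄ hf
    let T : Term L (Z ⊕ S) := t.bind (fun o => o.elim (t₀.bind (fun z => .var (.inl z)))
      (fun c => .var (.inr c)))
    have hT : ∀ f : Z → B, T.realize I (Sum.elim f (fun c => c.1.1)) = G₁ (t₀.realize I f) := by
      intro f
      rw [Term.realize_bind]
      congr 1
      funext o
      cases o with
      | none => exact Term.realize_bind _ _ _ _
      | some c => rfl
    rw [← hT, ← hT, ← hT, ← hT]
    refine hB.1 _ _ _ _ (is11Matrix_realize I T _ _ _ _ ?_)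
    rintro (z | c)
    · exact hf z
    · simp
  have diag : ∀ f₁ f₂ f₃ f₄ : Z → B,
      (∀ z, (f₁ z = f₂ z ∧ f₃ z = f₄ z) ∨ (f₁ z = f₃ z ∧ f₂ z = f₄ z)) →
      G₁ (t₀.realize I f₁) = G₂ (t₀.realize I f₂) →
      G₁ (t₀.realize I f₃) = G₂ (t₀.realize I f₄) := fun f₁ f₂ f₃ f₄ hf h =>
    (rows f₁ f₂ f₃ f₄ hf (h.trans (cross _ _ h))).trans (transfer _ _ (cross _ _ h).symm)
  unfold diagRel
  simp only [hG₁, hG₂]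
  refine ⟨⟨diag _ _ _ _ he, diag _ _ _ _ fun z => (he z).imp And.symm fun h =>
    ⟨h.1.symm, h.2.symm⟩⟩, fun h => ?_⟩
  rw [h, cross _ _ h, ← hθ.1.quot_mk_eq_iff, hθ.isHom_mk.map_realize, hθ.isHom_mk.map_realize]
  congr 1
  funext o
  cases o with
  | none => exact Quot.sound hqr
  | some c => rfl

/-- Let `B` be strongly abelian and `θ` a congruence on `B` such that
`B/θ` is abelian but not strongly rectangular. Then some quotient of some substructure
of `B × B` is not abelian. -/
theorem statement16 {L : Lang} {B : Type} (I : Interp L B)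
    (hB : IsStronglyAbelian I)
    (θ : B → B → Prop) (hθ : IsCong I θ)
    (habq : IsAbelian (quotInterp I θ))
    (hnsr : ¬ IsStronglyRectangular (quotInterp I θ)) :
    ∃ (S : Set (B × B)) (hS : IsSubuniverse (pairInterp I) S)
      (γ : S → S → Prop),
      IsCong (subInterp (pairInterp I) S hS) γ ∧
      ¬ IsAbelian (quotInterp (subInterp (pairInterp I) S hS) γ) := by
  unfold IsStronglyRectangular at hnsr
  push Not at hnsr
  obtain ⟨_, _, _, _, ⟨k, l, τ, ⟨m, t, c, ht⟩, a, b, u, v, rfl, rfl, rfl, rfl⟩, hqr, hrs⟩ := hnsr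
  simp only [ht] at hqr hrs
  let E : (Fin k → B) → (Fin l → B) → (Fin k ⊕ Fin l) ⊕ Fin m → B := fun x y =>
    Sum.elim (Sum.elim x y) (fun i => (c i).out)
  have hE : ∀ x y, Quot.mk θ (t.realize I (E (fun i => (x i).out) (fun j => (y j).out))) =
      t.realize (quotInterp I θ) (Sum.elim (Sum.elim x y) c) := by
    intro x y
    rw [hθ.isHom_mk.map_realize]
    congr 1
    funext z
    rcases z with (i | j) | n <;> exact Quot.out_eq _
  rw [← hE, ← hE] at hqr hrs
  generalize (fun i => (a i).out) = a' at hqr hrs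
  generalize (fun i => (b i).out) = b' at hqr hrs
  generalize (fun i => (u i).out) = u' at hqr hrs
  generalize (fun i => (v i).out) = v' at hqr hrs
  have hpr : ¬ θ (t.realize I (E a' u')) (t.realize I (E b' u')) := by
    intro hpr
    refine hrs (hqr.symm.trans ?_)
    rw [← hθ.1.quot_mk_eq_iff] at hpr
    simp only [hθ.isHom_mk.map_realize] at hpr ⊢
    refine habq _ _ _ _ (is11Matrix_realize _ t _ _ _ _ ?_) hpr
    rintro ((i | j) | n) <;> simp [E]
  have hS : IsSubuniverse (pairInterp I) (Set.univ : Set (B × B)) := fun _ _ _ => trivial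
  let J := subInterp (pairInterp I) Set.univ hS
  let γ := syntacticCong J (diagRel θ Set.univ)
  have hγ : IsCong J γ := isCong_syntacticCong J (equivalence_diagRel hθ.1 _)
  refine ⟨Set.univ, hS, γ, hγ, fun hab => hpr ?_⟩
  have hpair : ∀ f g : (Fin k ⊕ Fin l) ⊕ Fin m → B,
      t.realize J (fun z => ⟨(f z, g z), trivial⟩) =
        ⟨(t.realize I f, t.realize I g), trivial⟩ := by
    intro f g
    have fst_hom : IsHom J I (fun z => z.1.1) := fun _ _ => rfl
    have snd_hom : IsHom J I (fun z => z.1.2) := fun _ _ => rfl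
    exact Subtype.ext (Prod.ext (fst_hom.map_realize _ t) (snd_hom.map_realize _ t))
  have hrows : γ ⟨(t.realize I (E a' u'), t.realize I (E a' v')), trivial⟩
      ⟨(t.realize I (E b' u'), t.realize I (E b' v')), trivial⟩ := by
    refine syntacticCong_rows hB hθ hS t _ _ _ _ ?_ ((hθ.1.quot_mk_eq_iff _ _).1 hqr) _ _
    rintro ((i | j) | n) <;> simp [E]
  have hdiag : γ ⟨(t.realize I (E a' u'), t.realize I (E a' u')), trivial⟩
      ⟨(t.realize I (E b' u'), t.realize I (E b' u')), trivial⟩ := by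
    rw [← hpair, ← hpair, ← hγ.1.quot_mk_eq_iff] at hrows ⊢
    rw [hγ.isHom_mk.map_realize, hγ.isHom_mk.map_realize] at hrows ⊢
    refine hab _ _ _ _ (is11Matrix_realize _ t _ _ _ _ ?_) hrows
    rintro ((i | j) | n) <;> simp [E]
  exact hdiag.rel.2 rfl

end UA
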